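/- For every j ≥ 0 the row vector of polynomials 𝐏_{[0,j]}(λ) = (P_{0,0}(λ),…,P_{0,k_0−1}(λ),…,P_{j,0}(λ),…,P_{j,k_j−1}(λ)), where P_{i,k}(λ) = λ^k P_i(λ), satisfies the identity 𝐏_{[0,j]}(λ) · (λ·I − H_{[0,j]}) = (0, …, 0, b_j P_{j+1}(λ)), i.e. all coordinates of the product vanish except the last one, which equals b_j P_{j+1}(λ). -/

import Mathlib

open Polynomial

/-- Polynomials of the first kind: `P_0 = 1`, `P_1 = p_0 / b_0`, and
`b_{j+1} P_{j+2} = p_{j+1} P_{j+1} - ε_j ε_{j+1} b_j P_j`. -/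
noncomputable def genP (ε b : ℕ → ℝ) (p : ℕ → Polynomial ℝ) : ℕ → Polynomial ℝ
  | 0 => 1
  | 1 => Polynomial.C (b 0)⁻¹ * p 0
  | (j + 2) => Polynomial.C (b (j + 1))⁻¹ *
      (p (j + 1) * genP ε b p (j + 1) -
        Polynomial.C (ε j * ε (j + 1) * b j) * genP ε b p j)

/-- Polynomials of the second kind: `Q_0 = 0`, `Q_1 = ε_0 / b_0`, same recurrence. -/
noncomputable def genQ (ε b : ℕ → ℝ) (p : ℕ → Polynomial ℝ) : ℕ → Polynomial ℝ
  | 0 => 0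
  | 1 => Polynomial.C (ε 0 / b 0)
  | (j + 2) => Polynomial.C (b (j + 1))⁻¹ *
      (p (j + 1) * genQ ε b p (j + 1) -
        Polynomial.C (ε j * ε (j + 1) * b j) * genQ ε b p j)

/-- `nsum k j = n_j = k_0 + ⋯ + k_{j-1}`. -/
def nsum (k : ℕ → ℕ) (j : ℕ) : ℕ := ∑ i ∈ Finset.range j, k i

/-- The index `i` of the block containing the global row/column index `r`,
i.e. the greatest `i` with `n_i ≤ r` (assuming all `k i ≥ 1`). -/
def blkIdx (k : ℕ → ℕ) (r : ℕ) : ℕ := Nat.findGreatest (fun i => nsum k i ≤ r) r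

/-- Entry of the (infinite) generalized Jacobi matrix at global position `(r, c)`:
diagonal blocks are companion matrices `C_{p_i}`, subdiagonal blocks `B_i` have the
single nonzero entry `b_i` in the top-right corner, superdiagonal blocks `B̃_i` have
the single nonzero entry `ε_i ε_{i+1} b_i` in the top-right corner. -/
noncomputable def Jentry (ε b : ℕ → ℝ) (p : ℕ → Polynomial ℝ) (k : ℕ → ℕ) (r c : ℕ) : ℝ :=
  let i := blkIdx k r
  let i' := blkIdx k c
  let a := r - nsum k i
  let a' := c - nsum k i'
  if i = i' then
    (if a' = k i - 1 then -((p i).coeff a) else if a = a' + 1 then 1 else 0)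
  else if i = i' + 1 then
    (if a = 0 ∧ a' = k i' - 1 then b i' else 0)
  else if i' = i + 1 then
    (if a = 0 ∧ a' = k i' - 1 then ε i * ε i' * b i else 0)
  else 0

/-- The finite generalized Jacobi matrix built from the blocks indexed `0, …, m-1`;
it has size `n_m × n_m`.  Thus `H_{[0,j]} = JmatN ε b p k (j+1)`. -/
noncomputable def JmatN (ε b : ℕ → ℝ) (p : ℕ → Polynomial ℝ) (k : ℕ → ℕ) (m : ℕ) :
    Matrix (Fin (nsum k m)) (Fin (nsum k m)) ℝ :=
  Matrix.of fun r c => Jentry ε b p k (r : ℕ) (c : ℕ)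

/-- The row vector `𝐏_{[0,j]}(λ)` whose coordinate at global index `r = n_i + k`
(`0 ≤ k < k_i`) is `P_{i,k}(λ) = λ^k P_i(λ)`; here `m = j + 1` is the number of blocks. -/
noncomputable def PvecN (ε b : ℕ → ℝ) (p : ℕ → Polynomial ℝ) (k : ℕ → ℕ) (m : ℕ) :
    Fin (nsum k m) → Polynomial ℝ :=
  fun r => Polynomial.X ^ ((r : ℕ) - nsum k (blkIdx k (r : ℕ))) *
    genP ε b p (blkIdx k (r : ℕ))

theorem nsum_succ (k : ℕ → ℕ) (i : ℕ) : nsum k (i + 1) = nsum k i + k i :=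
  Finset.sum_range_succ k i

theorem nsum_mono (k : ℕ → ℕ) : Monotone (nsum k) :=
  monotone_nat_of_le_succ fun i => by rw [nsum_succ]; omega

theorem le_nsum {k : ℕ → ℕ} (hk : ∀ j, 1 ≤ k j) (i : ℕ) : i ≤ nsum k i := by
  induction i with
  | zero => exact Nat.zero_le _
  | succ i ih => rw [nsum_succ]; have := hk i; omega

theorem blkIdx_nsum_add {k : ℕ → ℕ} (hk : ∀ j, 1 ≤ k j) {i a : ℕ} (ha : a < k i) :
    blkIdx k (nsum k i + a) = i := by
  unfold blkIdx
  rw [Nat.findGreatest_eq_iff]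
  refine ⟨(le_nsum hk i).trans (Nat.le_add_right _ _), fun _ => Nat.le_add_right _ _, ?_⟩
  intro n hn _ h
  have := nsum_mono k (Nat.succ_le_of_lt hn)
  rw [Nat.succ_eq_add_one, nsum_succ] at this
  omega

theorem exists_eq_nsum_add (k : ℕ → ℕ) {m c : ℕ} (hc : c < nsum k m) :
    ∃ i a, i < m ∧ a < k i ∧ c = nsum k i + a := by
  induction m with
  | zero => simp [nsum] at hc
  | succ m ih =>
    by_cases h : c < nsum k m
    · obtain ⟨i, a, hi, ha, rfl⟩ := ih h
      exact ⟨i, a, by omega, ha, rfl⟩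
    · rw [nsum_succ] at hc
      exact ⟨m, c - nsum k m, by omega, by omega, by omega⟩

theorem sum_range_nsum {M : Type*} [AddCommMonoid M] (k : ℕ → ℕ) (g : ℕ → M) (m : ℕ) :
    ∑ r ∈ Finset.range (nsum k m), g r =
      ∑ i ∈ Finset.range m, ∑ a ∈ Finset.range (k i), g (nsum k i + a) := by
  induction m with
  | zero => simp [nsum]
  | succ m ih => rw [nsum_succ, Finset.sum_range_add, ih, Finset.sum_range_succ]

/-- The three-term recurrence, with the term of index `i - 1` written as a sum so that `i = 0`
needs no separate treatment. -/
theorem C_mul_genP_succ {ε b : ℕ → ℝ} (p : ℕ → ℝ[X]) (hb : ∀ j, 0 < b j) {i m : ℕ}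
    (hi : i < m) :
    C (b i) * genP ε b p (i + 1) = p i * genP ε b p i -
      ∑ l ∈ Finset.range m,
        if i = l + 1 then C (ε l * ε i * b l) * genP ε b p l else 0 := by
  have hC : C (b i) * C (b i)⁻¹ = (1 : ℝ[X]) := by
    rw [← C_mul, mul_inv_cancel₀ (hb i).ne', C_1]
  cases i with
  | zero => simp [genP, ← mul_assoc, hC]
  | succ i =>
    have h : i < m := by omega
    simp only [Nat.add_right_cancel_iff, Finset.sum_ite_eq, Finset.mem_range, h, if_true]
    rw [genP, ← mul_assoc, hC, one_mul]

/-- The row block `i` of the column at position `c` in block `i'`, paired with the powers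
`X ^ a`. -/
theorem sum_X_pow_mul_C_Jentry {ε b : ℕ → ℝ} {p : ℕ → ℝ[X]} {k : ℕ → ℕ}
    (hp : ∀ j, (p j).Monic) (hdeg : ∀ j, (p j).natDegree = k j) (hk : ∀ j, 1 ≤ k j)
    {i' c : ℕ} (hc : c < k i') (i : ℕ) :
    ∑ a ∈ Finset.range (k i), X ^ a * C (Jentry ε b p k (nsum k i + a) (nsum k i' + c)) =
      (if i = i' then X ^ (c + 1) - (if c = k i' - 1 then p i' else 0) else 0) +
      (if i = i' + 1 then (if c = k i' - 1 then C (b i') else 0) else 0) +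
      (if i' = i + 1 then (if c = k i' - 1 then C (ε i * ε i' * b i) else 0) else 0) := by
  have hJ : ∀ a ∈ Finset.range (k i),
      X ^ a * C (Jentry ε b p k (nsum k i + a) (nsum k i' + c)) =
      X ^ a * C (if i = i' then
        (if c = k i - 1 then -((p i).coeff a) else if a = c + 1 then 1 else 0)
        else if i = i' + 1 then (if a = 0 ∧ c = k i' - 1 then b i' else 0)
        else if i' = i + 1 then (if a = 0 ∧ c = k i' - 1 then ε i * ε i' * b i else 0)
        else 0) := by
    intro a ha
    simp only [Jentry, blkIdx_nsum_add hk (Finset.mem_range.1 ha), blkIdx_nsum_add hk hc,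
      Nat.add_sub_cancel_left]
  rw [Finset.sum_congr rfl hJ]
  have hpos := hk i
  rcases eq_or_ne i i' with rfl | h
  · by_cases hl : c = k i - 1
    · have hmon := (hp i).as_sum
      rw [hdeg] at hmon
      have hck : c + 1 = k i := by omega
      have hne : i ≠ i + 1 := by omega
      simp only [if_pos hl, if_true, hck, hne, if_false, C_neg, mul_neg, Finset.sum_neg_distrib,
        X_pow_mul_C]
      linear_combination hmon
    · have hck : c + 1 < k i := by omega
      simp [hl, apply_ite C, hck]
  · by_cases hl : c = k i' - 1
    · by_cases h1 : i = i' + 1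
      · have h2 : i' ≠ i + 1 := by omega
        simp only [if_pos h1, if_neg h, if_neg h2, hl, and_true, apply_ite C, if_true]
        simp [show k i ≠ 0 by omega]
      · by_cases h2 : i' = i + 1
        · simp [hl, h, h1, ← h2, apply_ite C]
          omega
        · simp [h, h1, h2]
    · simp [h, hl]

/-- For every `j ≥ 0`, the row vector `𝐏_{[0,j]}(λ)` satisfies
`𝐏_{[0,j]}(λ) · (λ·I − H_{[0,j]}) = (0, …, 0, b_j P_{j+1}(λ))`:
all coordinates vanish except the last one, which equals `b_j P_{j+1}(λ)`. -/
theorem Pvec_vecMul_charmatrix (ε b : ℕ → ℝ) (p : ℕ → Polynomial ℝ) (k : ℕ → ℕ)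
    (hε : ∀ j, ε j = 1 ∨ ε j = -1) (hb : ∀ j, 0 < b j)
    (hp : ∀ j, (p j).Monic) (hdeg : ∀ j, (p j).natDegree = k j) (hk : ∀ j, 1 ≤ k j) :
    ∀ j : ℕ,
      Matrix.vecMul (PvecN ε b p k (j + 1)) (Matrix.charmatrix (JmatN ε b p k (j + 1))) =
        fun (r : Fin (nsum k (j + 1))) => if (r : ℕ) = nsum k (j + 1) - 1
          then Polynomial.C (b j) * genP ε b p (j + 1) else 0 := by
  intro j
  funext c
  obtain ⟨i', a', hi', ha', hc⟩ := exists_eq_nsum_add k c.2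
  have hlast : (c : ℕ) = nsum k (j + 1) - 1 ↔ i' = j ∧ a' = k i' - 1 := by
    have h1 := hk i'
    have h2 := hk j
    have h3 := nsum_succ k j
    constructor
    · intro h
      have hij : i' = j := by
        by_contra hne
        have h4 := nsum_mono k (show i' + 1 ≤ j by omega)
        rw [nsum_succ] at h4
        omega
      subst hij
      exact ⟨rfl, by omega⟩
    · rintro ⟨rfl, h⟩
      omega
  have hcol : Matrix.vecMul (PvecN ε b p k (j + 1))
      (Matrix.charmatrix (JmatN ε b p k (j + 1))) c =
      X ^ (a' + 1) * genP ε b p i' - ∑ i ∈ Finset.range (j + 1),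
        (∑ a ∈ Finset.range (k i), X ^ a *
          C (Jentry ε b p k (nsum k i + a) (nsum k i' + a'))) * genP ε b p i := by
    simp only [Matrix.vecMul, dotProduct, Matrix.charmatrix_apply, mul_sub,
      Finset.sum_sub_distrib, Matrix.diagonal_apply, mul_ite, mul_zero, Finset.sum_ite_eq',
      Finset.mem_univ, if_true]
    congr 1
    · simp only [PvecN, hc, blkIdx_nsum_add hk ha', Nat.add_sub_cancel_left]
      ring
    · simp only [PvecN, JmatN, Matrix.of_apply, hc]
      rw [Fin.sum_univ_eq_sum_range (fun r => X ^ (r - nsum k (blkIdx k r)) *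
        genP ε b p (blkIdx k r) * C (Jentry ε b p k r (nsum k i' + a'))), sum_range_nsum]
      refine Finset.sum_congr rfl fun i _ => ?_
      rw [Finset.sum_mul]
      refine Finset.sum_congr rfl fun a ha => ?_
      simp only [blkIdx_nsum_add hk (Finset.mem_range.1 ha), Nat.add_sub_cancel_left]
      ring
  rw [hcol]
  simp only [sum_X_pow_mul_C_Jentry hp hdeg hk ha', add_mul, Finset.sum_add_distrib, ite_mul,
    zero_mul, Finset.sum_ite_eq', Finset.mem_range, hi', if_true, hlast]
  by_cases hl : a' = k i' - 1
  · simp only [if_pos hl, and_iff_left hl]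
    have hrec := C_mul_genP_succ (ε := ε) p hb hi'
    rcases eq_or_ne i' j with rfl | hne
    · simp only [lt_irrefl, if_true, if_false]
      linear_combination -hrec
    · have : i' + 1 < j + 1 := by omega
      simp only [this, hne, if_true, if_false]
      linear_combination -hrec
  · simp [hl]
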